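/- arXiv:0712.4075 — 2 statements merged into one kernel-verified Lean document; each statement's English description precedes it below -/
import Mathlib

section
/- Let R be a finite ring, let C be a linear code of length n over R with m × n parity-check matrix H all of whose rows have support of size d_j ≥ 4, and let C^{(χ)} be the cascaded code of length n + ∑_{j∈J}(d_j − 3) defined by imposing, for each j ∈ J with I_j = {i_1,…,i_{d_j}}, the parity-check equations b_{i_1}H_{j,i_1} + b_{i_2}H_{j,i_2} + χ^j_1 = 0; −χ^j_ℓ + b_{i_{ℓ+2}}H_{j,i_{ℓ+2}} + χ^j_{ℓ+1} = 0 for ℓ = 1,…,d_j−4; and −χ^j_{d_j−3} + b_{i_{d_j−1}}H_{j,i_{d_j−1}} + b_{i_{d_j}}H_{j,i_{d_j}} = 0. Then a vector b ∈ R^n is a codeword of C if and only if there exists χ = (χ^j)_{j∈J} with χ^j ∈ R^{d_j−3} such that (b | χ) ∈ C^{(χ)}. -/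
/-- `supp H j` is the support `I_j` of the `j`-th row of the parity-check matrix `H`. -/
def supp {R : Type*} [Zero R] [DecidableEq R] {m n : ℕ}
    (H : Matrix (Fin m) (Fin n) R) (j : Fin m) : Finset (Fin n) :=
  Finset.univ.filter (fun i => H j i ≠ 0)

/-- `en H j t` is the element `i_{t+1}` of `I_j = {i_1 < i_2 < ⋯ < i_{d_j}}`,
the increasing enumeration of the support of the `j`-th row. -/
def en {R : Type*} [Zero R] [DecidableEq R] {m n : ℕ}
    (H : Matrix (Fin m) (Fin n) R) (j : Fin m) (t : Fin (supp H j).card) : Fin n :=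
  ((supp H j).orderIsoOfFin rfl t : Fin n)

theorem cascade_row_aux {R : Type*} [Ring R] (k : ℕ) (f : Fin (k + 4) → R) :
    ∑ t, f t = 0 ↔ ∃ χ : Fin (k + 1) → R,
      (f ⟨0, by omega⟩ + f ⟨1, by omega⟩ + χ ⟨0, by omega⟩ = 0) ∧
      (∀ ℓ : ℕ, (hℓ : ℓ + 1 ≤ k) →
        -χ ⟨ℓ, by omega⟩ + f ⟨ℓ + 2, by omega⟩ + χ ⟨ℓ + 1, by omega⟩ = 0) ∧
      (-χ ⟨k, by omega⟩ + f ⟨k + 2, by omega⟩ + f ⟨k + 3, by omega⟩ = 0) := by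
  obtain ⟨g, hg⟩ : ∃ g : ℕ → R, ∀ (t : ℕ) (h : t < k + 4), f ⟨t, h⟩ = g t :=
    ⟨fun t => if h : t < k + 4 then f ⟨t, h⟩ else 0, fun t h => by simp [h]⟩
  have hs : ∑ t, f t = ∑ t ∈ Finset.range (k + 4), g t := by
    rw [Finset.sum_range]
    exact Finset.sum_congr rfl fun t _ => hg t.1 t.2
  rw [hs]
  simp only [hg]
  rw [Finset.sum_range_succ, Finset.sum_range_succ]
  constructor
  · intro h
    refine ⟨fun l => -∑ t ∈ Finset.range (l.1 + 2), g t, ?_, ?_, ?_⟩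
    · simp [Finset.sum_range_succ]
    · intro l _
      simp only
      rw [show l + 1 + 2 = (l + 2) + 1 by omega, Finset.sum_range_succ _ (l + 2)]
      abel
    · simpa using h
  · rintro ⟨χ, h0, h1, h2⟩
    have key : ∀ (l : ℕ) (hl : l < k + 1),
        -χ ⟨l, hl⟩ = ∑ t ∈ Finset.range (l + 2), g t := by
      intro l
      induction l with
      | zero =>
        intro hl
        rw [← eq_neg_iff_add_eq_zero] at h0
        simp [Finset.sum_range_succ, h0]
      | succ l ih =>
        intro hl
        rw [show l + 1 + 2 = (l + 2) + 1 by omega, Finset.sum_range_succ _ (l + 2),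
          ← ih (by omega)]
        exact (eq_neg_of_add_eq_zero_left (h1 l (by omega))).symm
    rw [key] at h2
    exact h2

theorem cascade_row {R : Type*} [Ring R] (d : ℕ) (hd : 4 ≤ d) (f : Fin d → R) :
    ∑ t, f t = 0 ↔ ∃ χ : Fin (d - 3) → R,
      (f ⟨0, by omega⟩ + f ⟨1, by omega⟩ + χ ⟨0, by omega⟩ = 0) ∧
      (∀ ℓ : ℕ, (hℓ : ℓ + 1 ≤ d - 4) →
        -χ ⟨ℓ, by omega⟩ + f ⟨ℓ + 2, by omega⟩ + χ ⟨ℓ + 1, by omega⟩ = 0) ∧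
      (-χ ⟨d - 4, by omega⟩ + f ⟨d - 2, by omega⟩ + f ⟨d - 1, by omega⟩ = 0) := by
  obtain ⟨k, rfl⟩ : ∃ k, d = k + 4 := ⟨d - 4, by omega⟩
  exact cascade_row_aux k f

/-- **Theorem 2.** A vector `b ∈ R^n` is a codeword of the code `C` with parity-check
matrix `H` (all of whose rows have support size `d_j ≥ 4`) iff there exist auxiliary
vectors `χ^j ∈ R^{d_j - 3}` such that `(b | χ)` satisfies all the cascaded three-term
parity checks (0-based indices: the paper's `b_{i_ℓ}` is `b (en H j ⟨ℓ-1, _⟩)` and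
`χ^j_ℓ` is `χ j ⟨ℓ-1, _⟩`). -/
theorem cascade_code_equivalence {R : Type*} [Ring R] [Fintype R] [DecidableEq R]
    {m n : ℕ} (H : Matrix (Fin m) (Fin n) R)
    (hd : ∀ j, 4 ≤ (supp H j).card) (b : Fin n → R) :
    (∀ j : Fin m, ∑ i ∈ supp H j, b i * H j i = 0) ↔
      ∃ χ : (j : Fin m) → Fin ((supp H j).card - 3) → R,
        ∀ j : Fin m,
          (b (en H j ⟨0, by have := hd j; omega⟩) *
              H j (en H j ⟨0, by have := hd j; omega⟩) +
            b (en H j ⟨1, by have := hd j; omega⟩) *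
              H j (en H j ⟨1, by have := hd j; omega⟩) +
            χ j ⟨0, by have := hd j; omega⟩ = 0) ∧
          (∀ ℓ : ℕ, (hℓ : ℓ + 1 ≤ (supp H j).card - 4) →
            -χ j ⟨ℓ, by have := hd j; omega⟩ +
              b (en H j ⟨ℓ + 2, by have := hd j; omega⟩) *
                H j (en H j ⟨ℓ + 2, by have := hd j; omega⟩) +
              χ j ⟨ℓ + 1, by have := hd j; omega⟩ = 0) ∧
          (-χ j ⟨(supp H j).card - 4, by have := hd j; omega⟩ +
            b (en H j ⟨(supp H j).card - 2, by have := hd j; omega⟩) *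
              H j (en H j ⟨(supp H j).card - 2, by have := hd j; omega⟩) +
            b (en H j ⟨(supp H j).card - 1, by have := hd j; omega⟩) *
              H j (en H j ⟨(supp H j).card - 1, by have := hd j; omega⟩) = 0) := by
  have hsum : ∀ j, ∑ i ∈ supp H j, b i * H j i = ∑ t, b (en H j t) * H j (en H j t) := by
    intro j
    rw [← Finset.sum_coe_sort]
    exact (Equiv.sum_comp ((supp H j).orderIsoOfFin rfl).toEquiv
      (fun i : supp H j => b i * H j i)).symm
  simp only [hsum]
  have hrow := fun j => cascade_row _ (hd j) (fun t => b (en H j t) * H j (en H j t))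
  constructor
  · intro h
    exact ⟨fun j => ((hrow j).1 (h j)).choose, fun j => ((hrow j).1 (h j)).choose_spec⟩
  · rintro ⟨χ, h⟩ j
    exact (hrow j).2 ⟨χ j, h j⟩
end

section
/- Let R be a finite ring with q elements and let C be a linear code of length n over R with m × n parity-check matrix H all of whose rows have support of size d_j ≥ 4. Let S be the polytope arising from the LP relaxation constraints applied to the cascaded code C^{(χ)} with parity-check matrix F, with points written as ((f, h), z) where f are the indicator variables for the code symbols b_i (i ∈ I) and h are the indicator variables for the auxiliary symbols χ^j_i. Then { f : ∃ h, z such that ((f,h), z) ∈ S } = { f : ∃ w such that (f, w) ∈ Q }; consequently, minimizing any linear cost function of f over S is equivalent to minimizing it over Q. -/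
/-- Support of the `j`-th row of a matrix `A` (generic index types). -/
def gsupp {R : Type*} [Zero R] [DecidableEq R] {J I : Type*} [Fintype I]
    (A : Matrix J I R) (j : J) : Finset I :=
  Finset.univ.filter (fun i => A j i ≠ 0)

/-- Local single-parity-check code of the `j`-th row of `A`: vectors supported on
`supp(A_j)` satisfying `∑_{i ∈ supp(A_j)} b i · A j i = 0`. -/
def glocC {R : Type*} [Ring R] [Fintype R] [DecidableEq R] {J I : Type*}
    [Fintype I] [DecidableEq I] (A : Matrix J I R) (j : J) : Finset (I → R) :=
  Finset.univ.filter (fun b =>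
    (∀ i, i ∉ gsupp A j → b i = 0) ∧ ∑ i ∈ gsupp A j, b i * A j i = 0)

/-- Membership in the LP relaxation polytope of [FSBG] for the code with
parity-check matrix `A`: indicator variables `g` together with auxiliary variables
`w = (w_{j,b})_{j, b ∈ C_j}` satisfying nonnegativity, normalization, and marginals. -/
def memLP {R : Type*} [Ring R] [Fintype R] [DecidableEq R] {J I : Type*}
    [Fintype I] [DecidableEq I]
    (A : Matrix J I R) (g : I → {α : R // α ≠ 0} → ℝ) (w : J → (I → R) → ℝ) : Prop :=
  (∀ j, ∀ b ∈ glocC A j, 0 ≤ w j b) ∧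
  (∀ j, ∑ b ∈ glocC A j, w j b = 1) ∧
  (∀ j, ∀ i ∈ gsupp A j, ∀ α : {α : R // α ≠ 0},
    g i α = ∑ b ∈ (glocC A j).filter (fun b => b i = (α : R)), w j b)

/-- The parity-check matrix `F` of the cascaded code `C^(χ)`. Its rows are indexed by
pairs `(j, r)` with `r < d_j - 2` and its columns by `Fin n ⊕ Σ j, Fin (d_j - 3)`
(original symbols `b_i` followed by auxiliary symbols `χ^j_ℓ`); `L` below is the
increasing enumeration `i_1 < ⋯ < i_{d_j}` of `I_j`. Row `(j, 0)` encodes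
`b_{i_1} H_{j,i_1} + b_{i_2} H_{j,i_2} + χ^j_1 = 0`; row `(j, r)` for `1 ≤ r ≤ d_j - 4`
encodes `-χ^j_r + b_{i_{r+2}} H_{j,i_{r+2}} + χ^j_{r+1} = 0` (0-based: `-χ^j` at `r-1`,
`+χ^j` at `r`, `b` at `L[r+1]`); row `(j, d_j - 3)` encodes
`-χ^j_{d_j-3} + b_{i_{d_j-1}} H_{j,i_{d_j-1}} + b_{i_{d_j}} H_{j,i_{d_j}} = 0`. -/
def casF {R : Type*} [Ring R] [Fintype R] [DecidableEq R] {m n : ℕ}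
    (H : Matrix (Fin m) (Fin n) R) :
    Matrix ((j : Fin m) × Fin ((gsupp H j).card - 2))
      (Fin n ⊕ (j : Fin m) × Fin ((gsupp H j).card - 3)) R :=
  fun jr col =>
    let j := jr.1
    let r : ℕ := (jr.2 : ℕ)
    let d := (gsupp H j).card
    match col with
    | Sum.inl i =>
        let L := (gsupp H j).sort (· ≤ ·)
        if r = 0 then (if L[0]? = some i ∨ L[1]? = some i then H j i else 0)
        else if r = d - 3 then
          (if L[d - 2]? = some i ∨ L[d - 1]? = some i then H j i else 0)
        else (if L[r + 1]? = some i then H j i else 0)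
    | Sum.inr s =>
        if s.1 = j then
          let l : ℕ := (s.2 : ℕ)
          if r = 0 then (if l = 0 then 1 else 0)
          else if r = d - 3 then (if l = d - 4 then -1 else 0)
          else (if l = r - 1 then -1 else if l = r then 1 else 0)
        else 0


open Finset in
lemma aux_couple {A B X : Type*} [Fintype A] [Fintype B] [DecidableEq X]
    (p : A → ℝ) (q : B → ℝ) (u : A → X) (v : B → X) (hp : ∀ a, 0 ≤ p a) (hq : ∀ b, 0 ≤ q b)
    (hm : ∀ x, ∑ a, (if u a = x then p a else 0) = ∑ b, (if v b = x then q b else 0)) :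
    ∃ r : A → B → ℝ, (∀ a b, 0 ≤ r a b) ∧ (∀ a b, r a b ≠ 0 → u a = v b) ∧
      (∀ a, ∑ b, r a b = p a) ∧ (∀ b, ∑ a, r a b = q b) := by
  set M : X → ℝ := fun x => ∑ a, (if u a = x then p a else 0) with hM
  have hM0 : ∀ x, 0 ≤ M x := fun x => sum_nonneg fun a _ => by split_ifs <;> simp [hp]
  have hpM : ∀ a, p a ≤ M (u a) := fun a => by
    have := single_le_sum (f := fun a' => if u a' = u a then p a' else 0)
      (fun a' _ => by split_ifs <;> simp [hp]) (mem_univ a)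
    simpa using this
  have hqM : ∀ b, q b ≤ M (v b) := fun b => by
    have := single_le_sum (f := fun b' => if v b' = v b then q b' else 0)
      (fun a' _ => by split_ifs <;> simp [hq]) (mem_univ b)
    simp only [hM, hm]
    simpa using this
  refine ⟨fun a b => if u a = v b then p a * q b / M (u a) else 0, ?_, ?_, ?_, ?_⟩
  · intro a b
    dsimp only
    split_ifs
    · exact div_nonneg (mul_nonneg (hp a) (hq b)) (hM0 _)
    · exact le_rfl
  · intro a b h
    by_contra hne
    simp [hne] at h
  · intro a
    have h1 : ∑ b, (if u a = v b then p a * q b / M (u a) else 0)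
        = p a / M (u a) * ∑ b, (if v b = u a then q b else 0) := by
      rw [mul_sum]
      refine sum_congr rfl fun b _ => ?_
      by_cases h : u a = v b
      · rw [if_pos h, if_pos h.symm]; ring
      · rw [if_neg h, if_neg (Ne.symm h)]; ring
    rw [h1, ← hm (u a)]
    change p a / M (u a) * M (u a) = p a
    by_cases h0 : M (u a) = 0
    · have := hpM a
      have := hp a
      rw [h0] at *
      simp
      linarith
    · field_simp
  · intro b
    have h1 : ∑ a, (if u a = v b then p a * q b / M (u a) else 0)
        = q b / M (v b) * M (v b) := by
      rw [hM, mul_sum]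
      refine sum_congr rfl fun a _ => ?_
      by_cases h : u a = v b
      · simp only [h, if_true]; ring
      · simp [h]
    rw [h1]
    by_cases h0 : M (v b) = 0
    · have := hqM b
      have := hq b
      rw [h0] at *
      simp
      linarith
    · field_simp

open Finset in
/-- Gluing of local distributions along a chain. -/
lemma aux_chain {I R : Type*} [Fintype I] [DecidableEq I] [Fintype R] [DecidableEq R] {N : ℕ}
    (T : Fin N → Finset I) (z : Fin N → (I → R) → ℝ) (hz : ∀ r b, 0 ≤ z r b)
    (hT : ∀ k (hk : k + 1 < N), ∃ x ∈ T ⟨k, by omega⟩,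
      (∀ r : Fin N, (r : ℕ) ≤ k → ∀ i ∈ T r, i ∈ T ⟨k + 1, hk⟩ → i = x) ∧
      ∀ α, ∑ b, (if b x = α then z ⟨k, by omega⟩ b else 0)
        = ∑ b, (if b x = α then z ⟨k + 1, hk⟩ b else 0)) :
    ∀ k, k < N → ∃ P : (I → R) → ℝ, (∀ b, 0 ≤ P b) ∧
      ∀ r : Fin N, (r : ℕ) ≤ k → ∀ φ : (I → R) → ℝ,
        (∀ b b', (∀ i ∈ T r, b i = b' i) → φ b = φ b') →
        ∑ b, P b * φ b = ∑ b, z r b * φ b := by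
  intro k
  induction k with
  | zero =>
    intro h0
    refine ⟨z ⟨0, h0⟩, hz _, ?_⟩
    intro r hr φ _
    have : r = ⟨0, h0⟩ := Fin.ext (by simpa using hr)
    rw [this]
  | succ k ih =>
    intro hk
    obtain ⟨P, hP, hPr⟩ := ih (by omega)
    obtain ⟨x, hx, hxT, hmarg⟩ := hT k hk
    obtain ⟨ρ, hρ0, hρs, hρa, hρb⟩ := aux_couple P (z ⟨k + 1, hk⟩) (fun b => b x) (fun b => b x)
      hP (hz _) (by
        intro α
        rw [← hmarg α]
        have := hPr ⟨k, by omega⟩ le_rfl (fun b => if b x = α then 1 else 0) (by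
          intro b b' h
          simp only [h x hx])
        simpa using this)
    let U : Set I := {i | ∃ r : Fin N, (r : ℕ) ≤ k ∧ i ∈ T r}
    classical
    let G : (I → R) → (I → R) → (I → R) := fun a b i => if i ∈ U then a i else b i
    have key : ∀ φ : (I → R) → ℝ,
        ∑ c, (∑ a, ∑ b, if G a b = c then ρ a b else 0) * φ c = ∑ a, ∑ b, ρ a b * φ (G a b) := by
      intro φ
      simp_rw [sum_mul]
      rw [sum_comm]
      refine sum_congr rfl fun a _ => ?_
      rw [sum_comm]
      refine sum_congr rfl fun b _ => ?_
      simp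
    refine ⟨fun c => ∑ a, ∑ b, if G a b = c then ρ a b else 0, ?_, ?_⟩
    · intro c
      refine sum_nonneg fun a _ => sum_nonneg fun b _ => ?_
      split_ifs
      · exact hρ0 a b
      · exact le_rfl
    · intro r hr φ hφ
      rw [key]
      rcases Nat.lt_or_ge k r with h | h
      · have hrk : r = ⟨k + 1, hk⟩ := Fin.ext (by simp; omega)
        subst hrk
        rw [sum_comm]
        refine sum_congr rfl fun b _ => ?_
        rw [← hρb b, sum_mul]
        refine sum_congr rfl fun a _ => ?_
        by_cases h0 : ρ a b = 0
        · simp [h0]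
        · congr 1
          apply hφ
          intro i hi
          by_cases hU : i ∈ U
          · obtain ⟨r, hr, hir⟩ := id hU
            have := hxT r hr i hir hi
            simp only [G, hU, if_true]
            rw [this]
            exact hρs a b h0
          · simp [G, hU]
      · rw [← hPr r h φ hφ]
        refine sum_congr rfl fun a _ => ?_
        rw [← hρa a, sum_mul]
        refine sum_congr rfl fun b _ => ?_
        congr 1
        apply hφ
        intro i hi
        have hU : i ∈ U := ⟨r, h, hi⟩
        simp [G, hU]

lemma aux_mem_gsupp {R : Type*} [Zero R] [DecidableEq R] {J I : Type*} [Fintype I]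
    (A : Matrix J I R) (j : J) (i : I) : i ∈ gsupp A j ↔ A j i ≠ 0 := by
  simp [gsupp]

open Finset in
lemma aux_sum_gsupp {R : Type*} [Ring R] [DecidableEq R] {J I : Type*} [Fintype I]
    (A : Matrix J I R) (j : J) (b : I → R) :
    ∑ i ∈ gsupp A j, b i * A j i = ∑ i, b i * A j i := by
  apply sum_subset (subset_univ _)
  intro i _ hi
  rw [aux_mem_gsupp, not_not] at hi
  simp [hi]

lemma aux_mem_glocC {R : Type*} [Ring R] [Fintype R] [DecidableEq R] {J I : Type*}
    [Fintype I] [DecidableEq I] (A : Matrix J I R) (j : J) (b : I → R) :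
    b ∈ glocC A j ↔ (∀ i, i ∉ gsupp A j → b i = 0) ∧ ∑ i, b i * A j i = 0 := by
  simp [glocC, aux_sum_gsupp]

lemma aux_casF_inr {R : Type*} [Ring R] [Fintype R] [DecidableEq R] {m n : ℕ}
    (H : Matrix (Fin m) (Fin n) R) (hd : ∀ j, 4 ≤ (gsupp H j).card)
    (j : Fin m) (r : Fin ((gsupp H j).card - 2)) (s : (j : Fin m) × Fin ((gsupp H j).card - 3)) :
    casF H ⟨j, r⟩ (Sum.inr s) =
      if s.1 = j then (if (r : ℕ) = s.2 then 1 else if (r : ℕ) = s.2 + 1 then -1 else 0) else 0 := by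
  obtain ⟨j', l⟩ := s
  by_cases h : j' = j
  · subst h
    have := hd j'
    have h1 := r.2
    have h2 := l.2
    simp only [casF, if_true]
    split_ifs <;> first | rfl | omega
  · simp [casF, h]

lemma aux_casF_inl {R : Type*} [Ring R] [Fintype R] [DecidableEq R] {m n : ℕ}
    (H : Matrix (Fin m) (Fin n) R) (hd : ∀ j, 4 ≤ (gsupp H j).card) (j : Fin m) (i : Fin n) :
    ∃ t : Fin ((gsupp H j).card - 2), ∀ r : Fin ((gsupp H j).card - 2),
    casF H ⟨j, r⟩ (Sum.inl i) = if r = t then H j i else 0 := by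
  have h4 := hd j
  by_cases hi : H j i = 0
  · refine ⟨⟨0, by omega⟩, fun r => ?_⟩
    simp [casF, hi]
  · have hmem : i ∈ (gsupp H j).sort (· ≤ ·) := by
      rw [Finset.mem_sort, aux_mem_gsupp]; exact hi
    obtain ⟨p, hp, hpi⟩ := List.getElem_of_mem hmem
    have hlen : ((gsupp H j).sort (· ≤ ·)).length = (gsupp H j).card := Finset.length_sort _
    have hnd : ((gsupp H j).sort (· ≤ ·)).Nodup := Finset.sort_nodup _ _
    have hq : ∀ q, ((gsupp H j).sort (· ≤ ·))[q]? = some i ↔ q = p := by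
      intro q
      rw [List.getElem?_eq_some_iff]
      constructor
      · rintro ⟨h, h'⟩
        exact (hnd.getElem_inj_iff).1 (h'.trans hpi.symm)
      · rintro rfl
        exact ⟨hp, hpi⟩
    rw [hlen] at hp
    refine ⟨⟨min (p - 1) ((gsupp H j).card - 3), by omega⟩, fun r => ?_⟩
    have h1 := r.2
    simp only [casF, hq, Fin.ext_iff]
    split_ifs <;> first | rfl | omega

open Finset in
lemma aux_trunc {R : Type*} [Ring R] [Fintype R] [DecidableEq R] {J I : Type*}
    [Fintype I] [DecidableEq I]
    (A : Matrix J I R) (g : I → {α : R // α ≠ 0} → ℝ) (w : J → (I → R) → ℝ)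
    (h : memLP A g w) : ∃ v : J → (I → R) → ℝ, (∀ j b, 0 ≤ v j b) ∧ (∀ j, ∑ b, v j b = 1) ∧
      (∀ j, ∀ i ∈ gsupp A j, ∀ α : {α : R // α ≠ 0},
        g i α = ∑ b, if b i = (α : R) then v j b else 0) ∧
      (∀ j b, v j b ≠ 0 → ∑ i, b i * A j i = 0) := by
  obtain ⟨h1, h2, h3⟩ := h
  refine ⟨fun j b => if b ∈ glocC A j then w j b else 0, ?_, ?_, ?_, ?_⟩
  · intro j b
    by_cases hb : b ∈ glocC A j
    · simpa [hb] using h1 j b hb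
    · simp [hb]
  · intro j
    rw [← h2 j, ← sum_filter]
    simp
  · intro j i hi α
    rw [h3 j i hi α, ← sum_filter, ← sum_filter]
    refine sum_congr ?_ fun _ _ => rfl
    ext b
    simp [and_comm]
  · intro j b hb
    by_cases hb' : b ∈ glocC A j
    · exact ((aux_mem_glocC A j b).1 hb').2
    · simp [hb'] at hb

open Finset in
lemma aux_push {R : Type*} [Ring R] [Fintype R] [DecidableEq R] {J I Ω : Type*}
    [Fintype I] [DecidableEq I] [Fintype Ω]
    (A : Matrix J I R) (j : J) (P : Ω → ℝ) (E : Ω → I → R) (hP : ∀ ω, 0 ≤ P ω)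
    (hP1 : ∑ ω, P ω = 1) (hE : ∀ ω, P ω ≠ 0 → ∑ i, E ω i * A j i = 0) :
    ∃ W : (I → R) → ℝ, (∀ b, 0 ≤ W b) ∧ ∑ b ∈ glocC A j, W b = 1 ∧
      ∀ i ∈ gsupp A j, ∀ α : R,
        ∑ ω, (if E ω i = α then P ω else 0) =
          ∑ b ∈ (glocC A j).filter (fun b => b i = α), W b := by
  let ρ : Ω → I → R := fun ω i => if i ∈ gsupp A j then E ω i else 0
  have hρ : ∀ ω, P ω ≠ 0 → ρ ω ∈ glocC A j := by
    intro ω h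
    rw [aux_mem_glocC]
    refine ⟨fun i hi => by simp [ρ, hi], ?_⟩
    rw [← hE ω h]
    refine sum_congr rfl fun i _ => ?_
    by_cases hi : i ∈ gsupp A j
    · simp [ρ, hi]
    · rw [aux_mem_gsupp, not_not] at hi
      simp [hi]
  refine ⟨fun b => ∑ ω, if ρ ω = b then P ω else 0, ?_, ?_, ?_⟩
  · intro b
    refine sum_nonneg fun ω _ => ?_
    split_ifs
    · exact hP ω
    · exact le_rfl
  · rw [sum_comm, ← hP1]
    refine sum_congr rfl fun ω _ => ?_
    rw [sum_ite_eq]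
    split_ifs with h
    · rfl
    · by_contra h'
      exact h (hρ ω (Ne.symm h'))
  · intro i hi α
    rw [sum_comm]
    refine sum_congr rfl fun ω _ => ?_
    rw [sum_ite_eq]
    by_cases h0 : P ω = 0
    · simp [h0]
    · simp [hρ ω h0, ρ, hi]

open Finset in
lemma aux_colsum {R : Type*} [Ring R] [Fintype R] [DecidableEq R] {m n : ℕ}
    (H : Matrix (Fin m) (Fin n) R) (hd : ∀ j, 4 ≤ (gsupp H j).card) (j : Fin m)
    (s : (j : Fin m) × Fin ((gsupp H j).card - 3)) :
    ∑ r, casF H ⟨j, r⟩ (Sum.inr s) = 0 := by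
  simp_rw [aux_casF_inr H hd]
  obtain ⟨j', l⟩ := s
  by_cases h : j' = j
  · subst h
    have h1 := hd j'
    have h2 := l.2
    have e : ∀ r : Fin ((gsupp H j').card - 2),
        (if (r : ℕ) = l then (1 : R) else if (r : ℕ) = l + 1 then -1 else 0) =
        (if r = ⟨l, by omega⟩ then 1 else 0) + (if r = ⟨l + 1, by omega⟩ then -1 else 0) := by
      intro r
      simp only [Fin.ext_iff]
      split_ifs <;> first | omega | simp
    simp only [if_true, e, sum_add_distrib]
    simp
  · simp [h]

open Finset in
lemma aux_toQ {R : Type*} [Ring R] [Fintype R] [DecidableEq R] {m n : ℕ}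
    (H : Matrix (Fin m) (Fin n) R) (hd : ∀ j, 4 ≤ (gsupp H j).card)
    (f : Fin n → {α : R // α ≠ 0} → ℝ)
    (h : ((j : Fin m) × Fin ((gsupp H j).card - 3)) → {α : R // α ≠ 0} → ℝ)
    (z : ((j : Fin m) × Fin ((gsupp H j).card - 2)) →
            ((Fin n ⊕ (j : Fin m) × Fin ((gsupp H j).card - 3)) → R) → ℝ)
    (hz : memLP (casF H) (Sum.elim f h) z) :
    ∃ w : Fin m → (Fin n → R) → ℝ, memLP H f w := by
  obtain ⟨v, hv0, hv1, hvm, hvs⟩ := aux_trunc _ _ _ hz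
  have main : ∀ j, ∃ W : (Fin n → R) → ℝ, (∀ b, 0 ≤ W b) ∧ ∑ b ∈ glocC H j, W b = 1 ∧
      ∀ i ∈ gsupp H j, ∀ α : {α : R // α ≠ 0},
        f i α = ∑ b ∈ (glocC H j).filter (fun b => b i = (α : R)), W b := by
    intro j
    have h4 := hd j
    have h10 : (1 : R) ≠ 0 := by
      intro h10
      obtain ⟨i, hi⟩ : (gsupp H j).Nonempty := card_pos.1 (by omega)
      rw [aux_mem_gsupp] at hi
      exact hi (by rw [← mul_one (H j i), h10, mul_zero])
    obtain ⟨P, hP0, hPr⟩ := aux_chain (fun r => gsupp (casF H) ⟨j, r⟩) (fun r => v ⟨j, r⟩)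
      (fun r => hv0 _) (by
        intro k hk
        have hx : Sum.inr ⟨j, ⟨k, by omega⟩⟩ ∈ gsupp (casF H) ⟨j, ⟨k, by omega⟩⟩ := by
          rw [aux_mem_gsupp, aux_casF_inr H hd]
          simpa using h10
        have hx' : Sum.inr ⟨j, ⟨k, by omega⟩⟩ ∈ gsupp (casF H) ⟨j, ⟨k + 1, hk⟩⟩ := by
          rw [aux_mem_gsupp, aux_casF_inr H hd]
          simpa using h10
        refine ⟨Sum.inr ⟨j, ⟨k, by omega⟩⟩, hx, ?_, ?_⟩
        · intro r hr i hi hi'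
          rw [aux_mem_gsupp] at hi hi'
          rcases i with i | ⟨j', l⟩
          · obtain ⟨t, ht⟩ := aux_casF_inl H hd j i
            rw [ht] at hi hi'
            have e1 : r = t := by
              by_contra hne
              simp [hne] at hi
            have e2 : (⟨k + 1, hk⟩ : Fin ((gsupp H j).card - 2)) = t := by
              by_contra hne
              simp [hne] at hi'
            rw [← e2] at e1
            rw [e1] at hr
            simp at hr
          · rw [aux_casF_inr H hd] at hi hi'
            by_cases hj : j' = j
            · subst hj
              have : (l : ℕ) = k := by
                by_contra hne
                have a1 : ¬ k + 1 = (l : ℕ) + 1 := by omega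
                simp only [if_true] at hi hi'
                by_cases a2 : k + 1 = (l : ℕ)
                · have a3 : ¬ (r : ℕ) = l := by omega
                  have a4 : ¬ (r : ℕ) = l + 1 := by omega
                  simp [a3, a4] at hi
                · rw [if_neg a2, if_neg a1] at hi'
                  exact hi' rfl
              have : l = ⟨k, by omega⟩ := Fin.ext this
              rw [this]
            · simp [hj] at hi
        · have hne : ∀ α : {α : R // α ≠ 0},
            ∑ b, (if b (Sum.inr ⟨j, ⟨k, by omega⟩⟩) = (α : R) then v ⟨j, ⟨k, by omega⟩⟩ b else 0)
            = ∑ b, (if b (Sum.inr ⟨j, ⟨k, by omega⟩⟩) = (α : R) then v ⟨j, ⟨k + 1, hk⟩⟩ b else 0) :=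
            fun α => (hvm _ _ hx α).symm.trans (hvm _ _ hx' α)
          have hsum : ∀ (x : Fin n ⊕ (j : Fin m) × Fin ((gsupp H j).card - 3))
            (p : ((Fin n ⊕ (j : Fin m) × Fin ((gsupp H j).card - 3)) → R) → ℝ),
              ∑ b, (if b x = 0 then p b else 0) =
              ∑ b, p b - ∑ α ∈ univ.erase (0 : R), ∑ b, (if b x = α then p b else 0) := by
            intro x p
            rw [eq_sub_iff_add_eq, add_sum_erase univ
              (fun α => ∑ b, (if b x = α then p b else 0)) (mem_univ (0 : R)), sum_comm]
            simp
          intro α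
          by_cases hα : α = 0
          · subst hα
            rw [hsum, hsum, hv1, hv1]
            congr 1
            refine sum_congr rfl fun α hα => ?_
            exact hne ⟨α, by simpa using hα⟩
          · exact hne ⟨α, hα⟩) ((gsupp H j).card - 3) (by omega)
    have hP1 : ∑ b, P b = 1 := by
      have := hPr ⟨0, by omega⟩ (by simp) (fun _ => 1) (fun _ _ _ => rfl)
      simpa [hv1] using this
    have hPs : ∀ b, P b ≠ 0 → ∀ r, ∑ i, b i * casF H ⟨j, r⟩ i = 0 := by
      intro b hb r
      by_contra hne
      have := hPr r (by have := r.2; omega)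
        (fun b => if ∑ i ∈ gsupp (casF H) ⟨j, r⟩, b i * casF H ⟨j, r⟩ i = 0 then 0 else 1) (by
          intro b b' hbb
          rw [sum_congr rfl fun i hi => by rw [hbb i hi]])
      have h0 : ∑ b, v ⟨j, r⟩ b *
        (if ∑ i ∈ gsupp (casF H) ⟨j, r⟩, b i * casF H ⟨j, r⟩ i = 0 then 0 else 1 : ℝ) = 0 := by
        refine sum_eq_zero fun b _ => ?_
        by_cases hvb : v ⟨j, r⟩ b = 0
        · simp [hvb]
        · rw [aux_sum_gsupp, hvs _ _ hvb]
          simp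
      rw [h0, sum_eq_zero_iff_of_nonneg] at this
      · have := this b (mem_univ b)
        rw [aux_sum_gsupp, if_neg hne] at this
        simp [hb] at this
      · intro b _
        refine mul_nonneg (hP0 b) ?_
        split_ifs <;> norm_num
    obtain ⟨W, hW0, hW1, hWm⟩ := aux_push H j P (fun b i => b (Sum.inl i)) hP0 hP1 (by
      intro b hb
      have hsum : ∑ r, ∑ i, b i * casF H ⟨j, r⟩ i = 0 :=
        sum_eq_zero fun r _ => hPs b hb r
      rw [sum_comm] at hsum
      simp_rw [← mul_sum] at hsum
      rw [Fintype.sum_sum_type] at hsum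
      simp_rw [aux_colsum H hd] at hsum
      simp only [mul_zero, sum_const_zero, add_zero] at hsum
      rw [← hsum]
      refine sum_congr rfl fun i _ => ?_
      obtain ⟨t, ht⟩ := aux_casF_inl H hd j i
      simp [ht])
    refine ⟨W, hW0, hW1, fun i hi α => ?_⟩
    rw [← hWm i hi α]
    obtain ⟨t, ht⟩ := aux_casF_inl H hd j i
    have hit : Sum.inl i ∈ gsupp (casF H) ⟨j, t⟩ := by
      rw [aux_mem_gsupp] at hi ⊢
      simpa [ht] using hi
    have e1 := hvm _ _ hit α
    have e2 := hPr t (by have := t.2; omega)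
      (fun b => if b (Sum.inl i) = (α : R) then 1 else 0) (by
        intro b b' hbb
        simp only [hbb _ hit])
    simp only [mul_ite, mul_one, mul_zero] at e2
    rw [e2]
    exact e1
  choose W hW0 hW1 hWm using main
  exact ⟨W, fun j b _ => hW0 j b, hW1, hWm⟩

open Finset in
lemma aux_toS {R : Type*} [Ring R] [Fintype R] [DecidableEq R] {m n : ℕ}
    (H : Matrix (Fin m) (Fin n) R) (hd : ∀ j, 4 ≤ (gsupp H j).card)
    (f : Fin n → {α : R // α ≠ 0} → ℝ)
    (w : Fin m → (Fin n → R) → ℝ) (hw : memLP H f w) :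
    ∃ (h : ((j : Fin m) × Fin ((gsupp H j).card - 3)) → {α : R // α ≠ 0} → ℝ)
          (z : ((j : Fin m) × Fin ((gsupp H j).card - 2)) →
            ((Fin n ⊕ (j : Fin m) × Fin ((gsupp H j).card - 3)) → R) → ℝ),
          memLP (casF H) (Sum.elim f h) z := by
  obtain ⟨v, hv0, hv1, hvm, hvs⟩ := aux_trunc _ _ _ hw
  choose t ht using aux_casF_inl H hd
  let S : Fin m → (Fin n → R) → ℕ → R := fun j b l =>
    -∑ i, if (t j i : ℕ) ≤ l then b i * H j i else 0
  let E : Fin m → (Fin n → R) → (Fin n ⊕ (j : Fin m) × Fin ((gsupp H j).card - 3)) → R :=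
    fun j b => Sum.elim b (fun s => if s.1 = j then S j b s.2 else 0)
  have main : ∀ jr : (j : Fin m) × Fin ((gsupp H j).card - 2), ∀ b, v jr.1 b ≠ 0 →
      ∑ c, E jr.1 b c * casF H jr c = 0 := by
    rintro ⟨j, r⟩ b hb
    have hb' := hvs j b hb
    have h4 := hd j
    have hr := r.2
    dsimp only
    rw [Fintype.sum_sum_type, Fintype.sum_sigma]
    rw [sum_eq_single (a := j) (s := univ) (f := fun x => ∑ y, _)]
    rotate_left
    · intro j' _ hj'
      refine sum_eq_zero fun l _ => ?_
      simp [E, hj']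
    · simp
    simp only [E, Sum.elim_inl, Sum.elim_inr, if_true, aux_casF_inr H hd, ht]
    -- total sum over the auxiliary symbols
    have hlast : S j b ((gsupp H j).card - 3) = 0 := by
      simp only [S]
      rw [neg_eq_zero, ← hb']
      refine sum_congr rfl fun i _ => ?_
      rw [if_pos]
      have := (t j i).2
      omega
    have hchi : ∑ l : Fin ((gsupp H j).card - 3), S j b l *
        (if (r : ℕ) = l then (1 : R) else if (r : ℕ) = l + 1 then -1 else 0) =
        S j b r - (if (r : ℕ) = 0 then 0 else S j b (r - 1)) := by
      have e : ∀ l : Fin ((gsupp H j).card - 3), S j b l *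
        (if (r : ℕ) = l then (1 : R) else if (r : ℕ) = l + 1 then -1 else 0) =
          (if (l : ℕ) = r then S j b r else 0) -
          (if (l : ℕ) + 1 = r then S j b (r - 1) else 0) := by
        intro l
        by_cases a1 : (r : ℕ) = l
        · simp [a1]
        · by_cases a2 : (r : ℕ) = l + 1
          · simp [a2]
          · simp [a1, a2, Ne.symm a1, Ne.symm a2]
      simp_rw [e]
      rw [sum_sub_distrib]
      congr 1
      · by_cases a : (r : ℕ) = (gsupp H j).card - 3
        · rw [a, hlast]
          simp
        · rw [sum_eq_single (a := (⟨r, by omega⟩ : Fin ((gsupp H j).card - 3)))]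
          · simp
          · intro l _ hl
            rw [if_neg]
            intro h'
            exact hl (Fin.ext h')
          · simp
      · by_cases a : (r : ℕ) = 0
        · rw [if_pos a]
          refine sum_eq_zero fun l _ => ?_
          rw [if_neg (by omega)]
        · rw [if_neg a]
          rw [sum_eq_single (a := (⟨r - 1, by omega⟩ : Fin ((gsupp H j).card - 3)))]
          · rw [if_pos]
            simp only
            omega
          · intro l _ hl
            rw [if_neg]
            intro h'
            exact hl (Fin.ext (by simp only; omega))
          · simp
    rw [hchi]
    by_cases a : (r : ℕ) = 0
    · simp only [a, if_true, S, sub_zero]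
      rw [add_neg_eq_zero]
      refine sum_congr rfl fun i _ => ?_
      have : (r = t j i) ↔ ((t j i : ℕ) ≤ 0) := by rw [Fin.ext_iff]; omega
      simp [this]
    · rw [if_neg a]
      simp only [S]
      rw [sub_neg_eq_add, ← add_assoc, add_right_comm, add_neg_eq_zero, ← sum_add_distrib]
      refine sum_congr rfl fun i _ => ?_
      simp only [Fin.ext_iff, mul_ite, mul_zero]
      split_ifs <;> first | omega | simp
  have main2 := fun jr : (j : Fin m) × Fin ((gsupp H j).card - 2) =>
    aux_push (casF H) jr (v jr.1) (E jr.1) (hv0 _) (hv1 _) (main jr)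
  choose z hz0 hz1 hzm using main2
  refine ⟨fun s α => ∑ b, if E s.1 b (Sum.inr s) = (α : R) then v s.1 b else 0, z,
    fun jr b _ => hz0 jr b, hz1, ?_⟩
  rintro ⟨j, r⟩ c hc α
  rw [← hzm _ c hc α]
  rcases c with i | s
  · have hi : i ∈ gsupp H j := by
      rw [aux_mem_gsupp] at hc ⊢
      intro h0
      simp [ht, h0] at hc
    exact hvm j i hi α
  · have hs : s.1 = j := by
      by_contra hne
      rw [aux_mem_gsupp, aux_casF_inr H hd] at hc
      simp [hne] at hc
    subst hs
    rfl

/-- **Theorem 3.** Writing points of the LP polytope `S` of the cascaded code `C^(χ)`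
as `((f, h), z)`, the projection of `S` onto the `f`-coordinates equals the projection
of the polytope `Q` (the LP polytope of the original code) onto the `f`-coordinates;
consequently optimizing any linear cost function of `f` over `S` is equivalent to
optimizing it over `Q`. -/
theorem projS_eq_projQ {R : Type*} [Ring R] [Fintype R] [DecidableEq R] {m n : ℕ}
    (H : Matrix (Fin m) (Fin n) R)
    (hd : ∀ j, 4 ≤ (gsupp H j).card) :
    {f : Fin n → {α : R // α ≠ 0} → ℝ |
        ∃ (h : ((j : Fin m) × Fin ((gsupp H j).card - 3)) → {α : R // α ≠ 0} → ℝ)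
          (z : ((j : Fin m) × Fin ((gsupp H j).card - 2)) →
            ((Fin n ⊕ (j : Fin m) × Fin ((gsupp H j).card - 3)) → R) → ℝ),
          memLP (casF H) (Sum.elim f h) z} =
      {f : Fin n → {α : R // α ≠ 0} → ℝ |
        ∃ w : Fin m → (Fin n → R) → ℝ, memLP H f w} := by
  ext f
  constructor
  · rintro ⟨h, z, hz⟩
    exact aux_toQ H hd f h z hz
  · rintro ⟨w, hw⟩
    exact aux_toS H hd f w hw
end
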